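/- Suppose (X,Y) are unit exponential with Pr(X>x,Y>y)=exp{−V(1/x,1/y)} where the spectral measure H of V has lower endpoint w_ℓ ∈ [0,1/2) with atom H({w_ℓ}) = m > 0 and no other atoms on [w_ℓ, w_u). With a(x) = {w_ℓ/(1−w_ℓ)}x and b(x)=1, for every z > 0, lim_{x→∞} Pr{Y > a(x) + z | X = x} = {1 − w_ℓ m} exp{−(1−w_ℓ) m z}; hence the limiting conditional distribution G satisfies G(z) = 1 − (1 − w_ℓ m)exp{−(1−w_ℓ)m z} for z > 0, G(z)=0 for z<0, with atom G({0}) = w_ℓ m. -/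

import Mathlib

open Real Set Filter Topology MeasureTheory

/-- Explicit form of the conditional survivor when the threshold is not an atom. -/
lemma survivor_formula (μ : Measure ℝ) [IsFiniteMeasure μ]
    (hμ : ∀ᵐ w ∂μ, 0 ≤ w ∧ w ≤ 1) (hmom : ∫ w, w ∂μ = 1)
    (V : ℝ → ℝ → ℝ)
    (hV : ∀ x > (0:ℝ), ∀ y > (0:ℝ), V x y = ∫ w, max (w / x) ((1 - w) / y) ∂μ)
    (x y : ℝ) (hx : 0 < x) (hy : 0 < y) (hne : ∀ᵐ w ∂μ, w * x ≠ (1 - w) * y) :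
    -(deriv (fun s => V s (x / y)) 1) * Real.exp (x - x * V 1 (x / y)) =
      (∫ w, Set.indicator {w : ℝ | (1 - w) * y < w * x} (fun w => w) w ∂μ) *
        Real.exp (-∫ w, max 0 ((1 - w) * y - w * x) ∂μ) := by
  have hr : 0 < x / y := div_pos hx hy
  have hS : MeasurableSet {w : ℝ | (1 - w) * y < w * x} :=
    measurableSet_lt (by fun_prop) (by fun_prop)
  have hidint : Integrable (fun w : ℝ => w) μ := by
    refine Integrable.of_bound (by fun_prop) 1 ?_
    filter_upwards [hμ] with w hw
    rw [Real.norm_eq_abs, abs_of_nonneg hw.1]; exact hw.2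
  have hcint : Integrable (fun w : ℝ => (1 - w) / (x / y)) μ :=
    ((integrable_const 1).sub hidint).div_const _
  have hder : HasDerivAt (fun s => ∫ w, max (w / s) ((1 - w) / (x / y)) ∂μ)
      (∫ w, -(Set.indicator {w : ℝ | (1 - w) * y < w * x} (fun w => w) w) ∂μ) 1 := by
    refine (hasDerivAt_integral_of_dominated_loc_of_lip (bound := fun _ => 4)
      (Metric.ball_mem_nhds (1:ℝ) (by norm_num : (0:ℝ) < 1/2)) ?_ ?_ ?_ ?_ ?_ ?_).2
    · exact Eventually.of_forall fun s => by fun_prop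
    · simp only [div_one]; exact hidint.sup hcint
    · exact ((measurable_id.indicator hS).neg).aestronglyMeasurable
    · filter_upwards [hμ] with w hw
      refine LipschitzOnWith.of_dist_le_mul ?_
      intro s hs s' hs'
      rw [Metric.mem_ball, Real.dist_eq, abs_lt] at hs hs'
      have h1 : 1/2 < s := by linarith
      have h2 : 1/2 < s' := by linarith
      rw [Real.dist_eq, Real.dist_eq]
      refine (abs_max_sub_max_le_abs _ _ _).trans ?_
      have e : w / s - w / s' = w / (s * s') * (s' - s) := by
        field_simp
      rw [e, abs_mul, abs_sub_comm s' s]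
      refine mul_le_mul_of_nonneg_right ?_ (abs_nonneg _)
      rw [abs_of_nonneg (by have := hw.1; positivity)]
      have : (1/4:ℝ) ≤ s * s' := by nlinarith
      simp
      rw [div_le_iff₀ (by positivity)]
      linarith [hw.2]
    · exact integrable_const _
    · filter_upwards [hne] with w hw
      have hcont : ContinuousAt (fun s : ℝ => w / s) 1 :=
        continuousAt_const.div continuousAt_id one_ne_zero
      have eq : (1 - w) / (x / y) = (1 - w) * y / x := by field_simp
      rcases lt_or_gt_of_ne hw with h | h
      · rw [Set.indicator_of_notMem (by simpa using h.le), neg_zero]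
        refine (hasDerivAt_const (1:ℝ) ((1 - w) / (x / y))).congr_of_eventuallyEq ?_
        have : w / 1 < (1 - w) / (x / y) := by
          rw [eq, lt_div_iff₀ hx]; simpa using h
        filter_upwards [hcont.eventually_lt continuousAt_const this] with s hs
        exact max_eq_right hs.le
      · rw [Set.indicator_of_mem (by simpa using h)]
        have hd : HasDerivAt (fun s : ℝ => w / s) (-w) 1 := by
          have := (hasDerivAt_inv (one_ne_zero (α := ℝ))).const_mul w
          simpa [div_eq_mul_inv] using this
        refine hd.congr_of_eventuallyEq ?_
        have : (1 - w) / (x / y) < w / 1 := by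
          rw [eq, div_lt_iff₀ hx]; simpa using h
        filter_upwards [continuousAt_const.eventually_lt hcont this] with s hs
        exact max_eq_left hs.le
  have hd2 : deriv (fun s => V s (x / y)) 1 =
      ∫ w, -(Set.indicator {w : ℝ | (1 - w) * y < w * x} (fun w => w) w) ∂μ := by
    refine (hder.congr_of_eventuallyEq ?_).deriv
    filter_upwards [lt_mem_nhds (one_pos (α := ℝ))] with s hs
    exact hV s hs _ hr
  have hV1 : x - x * V 1 (x / y) = -∫ w, max 0 ((1 - w) * y - w * x) ∂μ := by
    rw [hV 1 one_pos _ hr]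
    have hint2 : Integrable (fun w : ℝ => max (w / 1) ((1 - w) / (x / y))) μ := by
      simp only [div_one]; exact hidint.sup hcint
    have : x * ∫ w, max (w / 1) ((1 - w) / (x / y)) ∂μ
        - x * ∫ w, w ∂μ = ∫ w, max 0 ((1 - w) * y - w * x) ∂μ := by
      rw [← integral_const_mul, ← integral_const_mul, ← integral_sub (hint2.const_mul x)
        (hidint.const_mul x)]
      congr 1; ext w
      rw [mul_max_of_nonneg _ _ hx.le, ← max_sub_sub_right]
      congr 1
      · ring
      · field_simp
    rw [hmom] at this
    linarith
  rw [hd2, hV1, integral_neg, neg_neg]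

/-- For an inverted bivariate max-stable distribution with unit
exponential margins whose spectral measure `H` has lower endpoint
`wℓ ∈ [0,1/2)` carrying an atom of mass `m > 0`, no other atoms on
`[wℓ, wu)`, and density `h(w) ~ ℒ(w−wℓ)(w−wℓ)^t` as `w → wℓ⁺`, with
normings `a(x) = (wℓ/(1−wℓ))x`, `b(x) = 1`, the conditional survivor
`Pr(Y > a(x)+z | X = x) = −V₁(1, x/(a(x)+z)) exp{x − x V(1, x/(a(x)+z))}`
converges, for each `z > 0`, to `(1 − wℓ m) exp{−(1−wℓ) m z}`; for `z < 0` it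
converges to 1, so the limit law `G` has `G(z) = 1 − (1−wℓ m)e^{−(1−wℓ)mz}`
for `z > 0`, `G(z) = 0` for `z < 0`, with atom `G({0}) = wℓ m`. -/
theorem inverted_max_stable_atom_conditional_limit
    (wℓ wu m t : ℝ)
    (hwℓ : 0 ≤ wℓ) (hwℓhalf : wℓ < 1/2) (hwu : 1/2 < wu) (hwu1 : wu ≤ 1)
    (hm : 0 < m) (ht : -1 < t)
    (H : Measure ℝ) (hfin : IsFiniteMeasure H)
    (hsupp : H (Set.Icc wℓ wu)ᶜ = 0)
    (htotal : H (Set.Icc 0 1) = 2)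
    (hmoment : ∫ w in Set.Icc 0 1, w ∂H = 1)
    (hatom : (H {wℓ}).toReal = m)
    (hnoatom : ∀ w ∈ Set.Ico wℓ wu, w ≠ wℓ → H {w} = 0)
    -- density on the interior, regularly varying at wℓ with index t
    (h L : ℝ → ℝ)
    (hdens : ∀ A : Set ℝ, MeasurableSet A → A ⊆ Set.Ioo wℓ wu →
      H A = ENNReal.ofReal (∫ w in A, h w))
    (hslow : ∀ l > (0:ℝ), Tendsto (fun w => L (l * w) / L w)
      (nhdsWithin 0 (Set.Ioi 0)) (nhds 1))
    (hreg : Tendsto (fun w => h w / (L (w - wℓ) * (w - wℓ) ^ t))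
      (nhdsWithin wℓ (Set.Ioi wℓ)) (nhds 1))
    -- exponent measure and conditional survivor
    (V : ℝ → ℝ → ℝ)
    (hV : ∀ x > (0:ℝ), ∀ y > (0:ℝ),
      V x y = ∫ w in Set.Icc 0 1, max (w / x) ((1 - w) / y) ∂H)
    (P : ℝ → ℝ → ℝ)
    (hP : ∀ x > (0:ℝ), ∀ y > (0:ℝ),
      P x y = -(deriv (fun s => V s (x / y)) 1) * Real.exp (x - x * V 1 (x / y)))
    (hPnonpos : ∀ x > (0:ℝ), ∀ y ≤ (0:ℝ), P x y = 1)  -- Y > 0 a.s.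
    (a : ℝ → ℝ) (ha : ∀ x, a x = (wℓ / (1 - wℓ)) * x) :
    (∀ z > (0:ℝ),
        Tendsto (fun x => P x (a x + z)) atTop
          (nhds ((1 - wℓ * m) * Real.exp (-(1 - wℓ) * m * z)))) ∧
      (∀ z < (0:ℝ),
        Tendsto (fun x => P x (a x + z)) atTop (nhds 1)) := by
  have hfin' := hfin
  set μ := H.restrict (Set.Icc 0 1) with hμdef
  have h01 : ∀ᵐ w ∂μ, 0 ≤ w ∧ w ≤ 1 := by
    filter_upwards [ae_restrict_mem (μ := H) (measurableSet_Icc (a := (0:ℝ)) (b := 1))] with w hw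
    exact hw
  have hsup : ∀ᵐ w ∂μ, wℓ ≤ w := by
    refine ae_restrict_of_ae ?_
    have : ∀ᵐ w ∂H, w ∈ Set.Icc wℓ wu := hsupp
    filter_upwards [this] with w hw using hw.1
  have hmu : μ.real {wℓ} = m := by
    rw [← hatom, hμdef, Measure.real, Measure.restrict_apply (measurableSet_singleton _)]
    congr 2
    ext w
    simp only [Set.mem_inter_iff, Set.mem_singleton_iff, Set.mem_Icc, and_iff_left_iff_imp]
    rintro rfl
    constructor <;> linarith
  have hidint : Integrable (fun w : ℝ => w) μ := by
    refine Integrable.of_bound (by fun_prop) 1 ?_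
    filter_upwards [h01] with w hw
    rw [Real.norm_eq_abs, abs_of_nonneg hw.1]; exact hw.2
  have hl1 : 0 < 1 - wℓ := by linarith
  have hlin : ∀ x z w : ℝ, (1 - w) * (a x + z) - w * x
      = (1 - w) * z + x * ((wℓ - w) / (1 - wℓ)) := by
    intro x z w
    rw [ha]
    field_simp
    ring
  constructor
  · intro z hz
    have hpos : ∀ x > (0:ℝ), 0 < a x + z := by
      intro x hx
      rw [ha]
      have : 0 ≤ wℓ / (1 - wℓ) * x := by positivity
      linarith
    have hlim : Tendsto (fun x => (a x + z) / (x + (a x + z))) atTop (𝓝 wℓ) := by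
      have h1 : Tendsto (fun x : ℝ => (wℓ / (1 - wℓ) + z / x) /
          (1 + (wℓ / (1 - wℓ) + z / x))) atTop
          (𝓝 ((wℓ / (1 - wℓ) + 0) / (1 + (wℓ / (1 - wℓ) + 0)))) := by
        have h2 : Tendsto (fun x : ℝ => z / x) atTop (𝓝 0) :=
          tendsto_const_nhds.div_atTop tendsto_id
        have h3 : 0 ≤ wℓ / (1 - wℓ) := by positivity
        refine (tendsto_const_nhds.add h2).div
          (tendsto_const_nhds.add (tendsto_const_nhds.add h2)) (by positivity)
      have e : (wℓ / (1 - wℓ) + 0) / (1 + (wℓ / (1 - wℓ) + 0)) = wℓ := by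
        rw [add_zero]
        have : 1 + wℓ / (1 - wℓ) = 1 / (1 - wℓ) := by field_simp; ring
        rw [this]; field_simp
      rw [e] at h1
      refine h1.congr' ?_
      filter_upwards [eventually_gt_atTop 0] with x hx
      have h5 := hpos x hx
      rw [ha] at h5 ⊢
      have h6 : wℓ / (1 - wℓ) + z / x = (wℓ / (1 - wℓ) * x + z) / x := by
        field_simp
      have h7 : 1 + (wℓ / (1 - wℓ) * x + z) / x = (x + (wℓ / (1 - wℓ) * x + z)) / x := by
        field_simp
      rw [h6, h7, div_div_div_cancel_right₀ hx.ne']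
    have hform : ∀ᶠ x in atTop, (∫ w, Set.indicator {w : ℝ | (1 - w) * (a x + z) < w * x}
        (fun w => w) w ∂μ) * Real.exp (-∫ w, max 0 ((1 - w) * (a x + z) - w * x) ∂μ)
        = P x (a x + z) := by
      filter_upwards [eventually_gt_atTop 0,
        hlim.eventually (gt_mem_nhds (show wℓ < wu by linarith))] with x hx hlt
      have hy := hpos x hx
      rw [hP x hx _ hy]
      refine (survivor_formula μ h01 hmoment V hV x _ hx hy ?_).symm
      have hgt : wℓ < (a x + z) / (x + (a x + z)) := by
        rw [lt_div_iff₀ (by positivity)]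
        have := hlin x z wℓ
        simp only [sub_self, zero_div, mul_zero, add_zero] at this
        have h4 : 0 < (1 - wℓ) * z := by positivity
        linarith
      have h0 : H {(a x + z) / (x + (a x + z))} = 0 := hnoatom _ ⟨hgt.le, hlt⟩ hgt.ne'
      have h0' : ∀ᵐ w ∂H, w ≠ (a x + z) / (x + (a x + z)) := by
        rw [ae_iff]; simpa using h0
      filter_upwards [ae_restrict_of_ae h0'] with w hw heq
      apply hw
      rw [eq_div_iff (by positivity)]
      linarith
    refine Tendsto.congr' hform ?_
    have hlt_iff : ∀ x w : ℝ, (1 - w) * (a x + z) < w * x ↔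
        (1 - w) * z + x * ((wℓ - w) / (1 - wℓ)) < 0 := by
      intro x w
      rw [← hlin x z w, sub_neg]
    have hbot : ∀ w, wℓ < w → ∀ᶠ x in atTop,
        (1 - w) * z + x * ((wℓ - w) / (1 - wℓ)) < 0 := by
      intro w hw
      have hneg : (wℓ - w) / (1 - wℓ) < 0 := div_neg_of_neg_of_pos (by linarith) hl1
      exact (tendsto_atBot_add_const_left _ _
        (tendsto_id.atTop_mul_const_of_neg hneg)).eventually_lt_atBot 0
    have hT1 : Tendsto (fun x => ∫ w, Set.indicator {w : ℝ | (1 - w) * (a x + z) < w * x}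
        (fun w => w) w ∂μ) atTop (𝓝 (1 - wℓ * m)) := by
      have e : 1 - wℓ * m = ∫ w, (w - Set.indicator {wℓ} (fun _ => wℓ) w) ∂μ := by
        rw [integral_sub hidint ((integrable_const _).indicator (measurableSet_singleton _)),
          hmoment, integral_indicator_const _ (measurableSet_singleton _), hmu, smul_eq_mul,
          mul_comm]
      rw [e]
      refine tendsto_integral_filter_of_dominated_convergence (fun _ => 1) ?_ ?_
        (integrable_const _) ?_
      · exact Eventually.of_forall fun x => (measurable_id.indicator
          (measurableSet_lt (by fun_prop) (by fun_prop))).aestronglyMeasurable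
      · refine Eventually.of_forall fun x => ?_
        filter_upwards [h01] with w hw
        refine (norm_indicator_le_norm_self _ _).trans ?_
        rw [Real.norm_eq_abs, abs_of_nonneg hw.1]; exact hw.2
      · filter_upwards [hsup] with w hw
        refine tendsto_const_nhds.congr' ?_
        rcases hw.eq_or_lt with rfl | hw
        · refine Eventually.of_forall fun x => ?_
          have : ¬ ((1 - wℓ) * (a x + z) < wℓ * x) := by
            rw [hlt_iff]
            simp only [sub_self, zero_div, mul_zero, add_zero, not_lt]
            positivity
          beta_reduce
          rw [Set.indicator_of_notMem (show wℓ ∉ {w : ℝ | (1 - w) * (a x + z) < w * x} from this)]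
          simp
        · filter_upwards [hbot w hw] with x hx
          rw [Set.indicator_of_mem (show w ∈ {w : ℝ | (1 - w) * (a x + z) < w * x} from
            (hlt_iff x w).2 hx), Set.indicator_of_notMem (by simpa using hw.ne'), sub_zero]
    have hT2 : Tendsto (fun x => ∫ w, max 0 ((1 - w) * (a x + z) - w * x) ∂μ) atTop
        (𝓝 ((1 - wℓ) * m * z)) := by
      have e : (1 - wℓ) * m * z = ∫ w, Set.indicator {wℓ} (fun _ => (1 - wℓ) * z) w ∂μ := by
        rw [integral_indicator_const _ (measurableSet_singleton _), hmu, smul_eq_mul]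
        ring
      rw [e]
      refine tendsto_integral_filter_of_dominated_convergence (fun _ => z) ?_ ?_
        (integrable_const _) ?_
      · exact Eventually.of_forall fun x => by fun_prop
      · filter_upwards [eventually_gt_atTop 0] with x hx
        filter_upwards [h01, hsup] with w hw hw2
        rw [Real.norm_eq_abs, abs_of_nonneg (le_max_left _ _), hlin]
        have : x * ((wℓ - w) / (1 - wℓ)) ≤ 0 :=
          mul_nonpos_of_nonneg_of_nonpos hx.le
            (div_nonpos_of_nonpos_of_nonneg (by linarith) hl1.le)
        refine max_le hz.le ?_
        nlinarith [mul_nonneg hw.1 hz.le]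
      · filter_upwards [hsup] with w hw
        refine tendsto_const_nhds.congr' ?_
        rcases hw.eq_or_lt with rfl | hw
        · refine Eventually.of_forall fun x => ?_
          beta_reduce
          rw [hlin, Set.indicator_of_mem (Set.mem_singleton _)]
          simp only [sub_self, zero_div, mul_zero, add_zero]
          rw [max_eq_right (by positivity)]
        · filter_upwards [hbot w hw] with x hx
          rw [hlin, Set.indicator_of_notMem (by simpa using hw.ne'), max_eq_left hx.le]
    have e : -(1 - wℓ) * m * z = -((1 - wℓ) * m * z) := by ring
    rw [e]
    exact hT1.mul ((Real.continuous_exp.tendsto _).comp hT2.neg)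
  · intro z hz
    refine tendsto_const_nhds.congr' ?_
    filter_upwards [eventually_gt_atTop 0] with x hx
    rcases le_or_gt (a x + z) 0 with hy | hy
    · exact (hPnonpos x hx _ hy).symm
    have hneg : ∀ᵐ w ∂μ, (1 - w) * (a x + z) - w * x < 0 := by
      filter_upwards [h01, hsup] with w hw hw2
      have h1 := hlin x z wℓ
      simp only [sub_self, zero_div, mul_zero, add_zero] at h1
      have h2 : (1 - wℓ) * z < 0 := mul_neg_of_pos_of_neg hl1 hz
      nlinarith [mul_le_mul_of_nonneg_right hw2 hy.le, mul_le_mul_of_nonneg_right hw2 hx.le]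
    rw [hP x hx _ hy, survivor_formula μ h01 hmoment V hV x _ hx hy
      (by filter_upwards [hneg] with w hw heq; linarith)]
    have e1 : ∫ w, Set.indicator {w : ℝ | (1 - w) * (a x + z) < w * x} (fun w => w) w ∂μ
        = 1 := by
      refine Eq.trans (integral_congr_ae ?_) hmoment
      filter_upwards [hneg] with w hw
      rw [Set.indicator_of_mem (show w ∈ {w : ℝ | (1 - w) * (a x + z) < w * x} from
        sub_neg.1 hw)]
    have e2 : ∫ w, max 0 ((1 - w) * (a x + z) - w * x) ∂μ = 0 := by
      refine integral_eq_zero_of_ae ?_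
      filter_upwards [hneg] with w hw
      exact max_eq_left hw.le
    rw [e1, e2]
    simp
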